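/- Suppose the zero-sum game given by M has a unique Nash equilibrium (p̄,q̄), completely mixed. Then for ρ > 0 sufficiently small, every half-ray in Σ_p × Σ_q emanating from (p̄,q̄) intersects the level set H^{-1}(ρ) in exactly one point; consequently H^{-1}(ρ) is homeomorphic to the sphere S^{m+n-3}. -/

import Mathlib

open Matrix

/-- The "duality gap" Hamiltonian of the zero-sum game with payoff matrix `M`:
`H(p,q) = max_{p'∈Σ_p} p'ᵀ M q − min_{q'∈Σ_q} pᵀ M q'`. -/
noncomputable def H {m n : ℕ} (M : Matrix (Fin m) (Fin n) ℝ)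
    (p : Fin m → ℝ) (q : Fin n → ℝ) : ℝ :=
  sSup ((fun p' => p' ⬝ᵥ M *ᵥ q) '' stdSimplex ℝ (Fin m)) -
    sInf ((fun q' => p ⬝ᵥ M *ᵥ q') '' stdSimplex ℝ (Fin n))

/-- A level set of a continuous, positively homogeneous function that is positive away from the
origin is homeomorphic to the unit sphere, by radial projection. -/
noncomputable def levelSetHomeomorphSphere {F : Type*} [NormedAddCommGroup F] [NormedSpace ℝ F]
    (g : F → ℝ) (hc : Continuous g) (hom : ∀ t : ℝ, 0 < t → ∀ x, g (t • x) = t * g x)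
    (hpos : ∀ x, x ≠ 0 → 0 < g x) (ρ : ℝ) (hρ : 0 < ρ) :
    {x // g x = ρ} ≃ₜ Metric.sphere (0 : F) 1 :=
  have g0 : g 0 = 0 := by
    have := hom 2 two_pos 0
    rw [smul_zero] at this
    linarith
  have hx0 : ∀ x : {x // g x = ρ}, 0 < ‖x.1‖ := fun x => by
    refine norm_pos_iff.2 fun h => ?_
    have := x.2
    rw [h, g0] at this
    exact hρ.ne this
  have hy0 : ∀ y : Metric.sphere (0 : F) 1, 0 < g y.1 := fun y =>
    hpos _ (ne_zero_of_mem_unit_sphere y)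
  { toFun := fun x => ⟨‖x.1‖⁻¹ • x.1, by
      simp [norm_smul, (hx0 x).ne']⟩
    invFun := fun y => ⟨(ρ / g y.1) • y.1, by
      rw [hom _ (div_pos hρ (hy0 y)), div_mul_cancel₀ _ (hy0 y).ne']⟩
    left_inv := fun x => by
      have hx := (hx0 x).ne'
      ext
      simp only [hom _ (inv_pos.2 (hx0 x)), x.2, smul_smul]
      rw [show ρ / (‖x.1‖⁻¹ * ρ) * ‖x.1‖⁻¹ = 1 by field_simp, one_smul]
    right_inv := fun y => by
      have hy : ‖y.1‖ = 1 := by simp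
      have ht := div_pos hρ (hy0 y)
      ext1
      simp only [norm_smul, hy, mul_one, Real.norm_of_nonneg ht.le, smul_smul]
      rw [inv_mul_cancel₀ ht.ne', one_smul]
    continuous_toFun := by
      refine Continuous.subtype_mk (Continuous.smul (Continuous.inv₀ (by fun_prop)
        fun x => (hx0 x).ne') continuous_subtype_val) _
    continuous_invFun := by
      refine Continuous.subtype_mk (Continuous.smul (Continuous.div continuous_const
        (by fun_prop) fun y => (hy0 y).ne') continuous_subtype_val) _ }

lemma nonempty_homeomorph_sphere_of_finrank_eq {E F X : Type*} [NormedAddCommGroup E]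
    [NormedSpace ℝ E] [FiniteDimensional ℝ E] [NormedAddCommGroup F] [NormedSpace ℝ F]
    [FiniteDimensional ℝ F] [TopologicalSpace X]
    (hfr : Module.finrank ℝ E = Module.finrank ℝ F)
    (g : E → ℝ) (hc : Continuous g) (hom : ∀ t : ℝ, 0 < t → ∀ x, g (t • x) = t * g x)
    (hpos : ∀ x, x ≠ 0 → 0 < g x) {ρ : ℝ} (hρ : 0 < ρ) (e₁ : X ≃ₜ {x // g x = ρ}) :
    Nonempty (X ≃ₜ Metric.sphere (0 : F) 1) := by
  let e : E ≃L[ℝ] F := ContinuousLinearEquiv.ofFinrankEq hfr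
  have e₂ : {x // g x = ρ} ≃ₜ {y // g (e.symm y) = ρ} := e.toHomeomorph.subtype fun y => by simp
  refine ⟨(e₁.trans e₂).trans (levelSetHomeomorphSphere (fun y => g (e.symm y))
    (hc.comp e.symm.continuous) (fun t ht y => ?_) (fun y hy => hpos _ ?_) ρ hρ)⟩
  · rw [map_smul, hom t ht]
  · simpa using hy

/-- A continuous, positively homogeneous function on a proper space that is positive away from the
origin dominates a positive multiple of the norm. -/
lemma exists_pos_mul_norm_le {F : Type*} [NormedAddCommGroup F] [NormedSpace ℝ F] [ProperSpace F]
    (g : F → ℝ) (hc : Continuous g) (hom : ∀ t : ℝ, 0 < t → ∀ x, g (t • x) = t * g x)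
    (hpos : ∀ x, x ≠ 0 → 0 < g x) : ∃ c > 0, ∀ x, c * ‖x‖ ≤ g x := by
  obtain ⟨c, hc0, h⟩ := (isCompact_sphere (0 : F) 1).exists_forall_le' hc.continuousOn (a := 0)
    fun x hx => hpos x (ne_zero_of_mem_unit_sphere ⟨x, hx⟩)
  refine ⟨c, hc0, fun x => ?_⟩
  rcases eq_or_ne x 0 with rfl | hx
  · have := hom 2 two_pos 0
    rw [smul_zero] at this
    rw [norm_zero]
    linarith
  · have hn := norm_pos_iff.2 hx
    have := h (‖x‖⁻¹ • x) (by simp [norm_smul, hn.ne'])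
    rw [hom _ (inv_pos.2 hn)] at this
    rwa [inv_mul_eq_div, le_div_iff₀ hn] at this

lemma dotProduct_le_of_mem_stdSimplex {ι : Type*} [Fintype ι] {p x : ι → ℝ} {a : ℝ} (hp : p ∈ stdSimplex ℝ ι)
    (h : ∀ i, x i ≤ a) : p ⬝ᵥ x ≤ a := by
  calc p ⬝ᵥ x ≤ ∑ i, p i * a := Finset.sum_le_sum fun i _ =>
        mul_le_mul_of_nonneg_left (h i) (hp.1 i)
    _ = a := by rw [← Finset.sum_mul, hp.2, one_mul]

/-- The largest coordinate of a vector. -/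
noncomputable def maxCoord {ι : Type*} [Fintype ι] [Nonempty ι] (x : ι → ℝ) : ℝ :=
  Finset.univ.sup' Finset.univ_nonempty x

section MaxCoord

variable {ι : Type*} [Fintype ι] [Nonempty ι]

lemma le_maxCoord (x : ι → ℝ) (i : ι) : x i ≤ maxCoord x :=
  Finset.le_sup' x (Finset.mem_univ i)

lemma maxCoord_le {x : ι → ℝ} {a : ℝ} (h : ∀ i, x i ≤ a) : maxCoord x ≤ a :=
  Finset.sup'_le _ _ fun i _ => h i

lemma exists_eq_maxCoord (x : ι → ℝ) : ∃ i, maxCoord x = x i := by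
  obtain ⟨i, -, hi⟩ := Finset.exists_mem_eq_sup' Finset.univ_nonempty x
  exact ⟨i, hi⟩

lemma continuous_maxCoord : Continuous (maxCoord : (ι → ℝ) → ℝ) :=
  Continuous.finset_sup'_apply _ fun i _ => continuous_apply i

lemma maxCoord_smul {t : ℝ} (ht : 0 < t) (x : ι → ℝ) : maxCoord (t • x) = t * maxCoord x := by
  refine le_antisymm (maxCoord_le fun i => ?_) ?_
  · exact mul_le_mul_of_nonneg_left (le_maxCoord x i) ht.le
  · obtain ⟨i, hi⟩ := exists_eq_maxCoord x
    rw [hi]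
    exact le_maxCoord (t • x) i

lemma maxCoord_const_add (c : ℝ) (x : ι → ℝ) :
    maxCoord (fun i => c + x i) = c + maxCoord x := by
  refine le_antisymm (maxCoord_le fun i => ?_) ?_
  · have := le_maxCoord x i
    linarith
  · obtain ⟨i, hi⟩ := exists_eq_maxCoord x
    rw [hi]
    exact le_maxCoord (fun i => c + x i) i

lemma isGreatest_maxCoord (x : ι → ℝ) :
    IsGreatest ((fun p => p ⬝ᵥ x) '' stdSimplex ℝ ι) (maxCoord x) := by
  classical
  constructor
  · obtain ⟨i, hi⟩ := exists_eq_maxCoord x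
    exact ⟨Pi.single i 1, single_mem_stdSimplex ℝ i, by simp [hi]⟩
  · rintro _ ⟨p, hp, rfl⟩
    exact dotProduct_le_of_mem_stdSimplex hp (le_maxCoord x)

lemma maxCoord_nonneg {p x : ι → ℝ} (hp : p ∈ stdSimplex ℝ ι) (h : p ⬝ᵥ x = 0) :
    0 ≤ maxCoord x :=
  h ▸ dotProduct_le_of_mem_stdSimplex hp (le_maxCoord x)

end MaxCoord

lemma eq_const_of_le_of_dotProduct_eq {ι : Type*} [Fintype ι] {p x : ι → ℝ} {a : ℝ}
    (hp : p ∈ stdSimplex ℝ ι) (hpos : ∀ i, 0 < p i) (h : ∀ i, x i ≤ a) (he : p ⬝ᵥ x = a) :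
    ∀ i, x i = a := by
  have h0 : ∑ i, p i * (a - x i) = 0 := by
    simp only [mul_sub, Finset.sum_sub_distrib, ← Finset.sum_mul, hp.2]
    rw [dotProduct] at he
    linarith
  intro i
  have := (Finset.sum_eq_zero_iff_of_nonneg fun i _ =>
    mul_nonneg (hpos i).le (sub_nonneg.2 (h i))).1 h0 i (Finset.mem_univ i)
  rcases mul_eq_zero.1 this with h | h
  · exact absurd h (hpos i).ne'
  · linarith

lemma H_eq_maxCoord {m n : ℕ} [NeZero m] [NeZero n] (M : Matrix (Fin m) (Fin n) ℝ)
    (p : Fin m → ℝ) (q : Fin n → ℝ) :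
    H M p q = maxCoord (M *ᵥ q) + maxCoord (-(p ᵥ* M)) := by
  have h : IsLeast ((fun q' => p ⬝ᵥ M *ᵥ q') '' stdSimplex ℝ (Fin n))
      (-maxCoord (-(p ᵥ* M))) := by
    obtain ⟨⟨q₀, hq₀, h⟩, h'⟩ := isGreatest_maxCoord (-(p ᵥ* M))
    simp only [dotProduct_neg] at h
    refine ⟨⟨q₀, hq₀, ?_⟩, ?_⟩
    · simp only [dotProduct_mulVec, ← h, neg_neg, dotProduct_comm]
    · rintro _ ⟨q', hq', rfl⟩
      have := h' ⟨q', hq', rfl⟩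
      simp only [dotProduct_neg] at this
      simp only [dotProduct_mulVec]
      rw [dotProduct_comm]
      linarith
  rw [H, (isGreatest_maxCoord (M *ᵥ q)).csSup_eq, h.csInf_eq, sub_neg_eq_add]

lemma exists_add_mem_stdSimplex {ι : Type*} [Fintype ι] [Nonempty ι] {p : ι → ℝ}
    (hp : p ∈ stdSimplex ℝ ι) (hpos : ∀ i, 0 < p i) :
    ∃ δ > 0, ∀ u : ι → ℝ, ∑ i, u i = 0 → ‖u‖ < δ → p + u ∈ stdSimplex ℝ ι := by
  refine ⟨Finset.univ.inf' Finset.univ_nonempty p, ?_, fun u hu hn => ⟨fun i => ?_, ?_⟩⟩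
  · simpa using hpos
  · have h1 := (norm_le_pi_norm u i).trans_lt (hn.trans_le (Finset.inf'_le p (Finset.mem_univ i)))
    have := (abs_lt.1 h1).1
    simp only [Pi.add_apply]
    linarith
  · simp [Finset.sum_add_distrib, hu, hp.2]

/-- The subspace of vectors whose coordinates sum to zero. -/
noncomputable def sumZero (ι : Type*) [Fintype ι] : Submodule ℝ (ι → ℝ) :=
  LinearMap.ker (∑ i, LinearMap.proj i : (ι → ℝ) →ₗ[ℝ] ℝ)

lemma mem_sumZero {ι : Type*} [Fintype ι] {u : ι → ℝ} : u ∈ sumZero ι ↔ ∑ i, u i = 0 := by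
  simp [sumZero]

lemma finrank_sumZero (ι : Type*) [Fintype ι] [Nonempty ι] :
    Module.finrank ℝ (sumZero ι) + 1 = Fintype.card ι := by
  classical
  have hs : Function.Surjective (∑ i, LinearMap.proj i : (ι → ℝ) →ₗ[ℝ] ℝ) := fun x =>
    ⟨Pi.single (Classical.arbitrary ι) x, by simp⟩
  have := LinearMap.finrank_range_add_finrank_ker (∑ i, LinearMap.proj i : (ι → ℝ) →ₗ[ℝ] ℝ)
  rw [LinearMap.range_eq_top.2 hs, finrank_top, Module.finrank_self,
    Module.finrank_fintype_fun_eq_card] at this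
  rw [sumZero]
  omega

lemma sub_mem_sumZero {ι : Type*} [Fintype ι] {p p' : ι → ℝ} (hp : p ∈ stdSimplex ℝ ι)
    (hp' : p' ∈ stdSimplex ℝ ι) : p - p' ∈ sumZero ι := by
  simp [mem_sumZero, hp.2, hp'.2]

section Game

variable {m n : ℕ} [NeZero m] [NeZero n] (M : Matrix (Fin m) (Fin n) ℝ)

lemma H_smul {t : ℝ} (ht : 0 < t) (u : Fin m → ℝ) (w : Fin n → ℝ) :
    H M (t • u) (t • w) = t * H M u w := by
  simp only [H_eq_maxCoord, mulVec_smul, smul_vecMul, ← smul_neg, maxCoord_smul ht, mul_add]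

lemma continuous_H : Continuous fun x : (Fin m → ℝ) × (Fin n → ℝ) => H M x.1 x.2 := by
  simp only [H_eq_maxCoord]
  exact (continuous_maxCoord.comp (continuous_const.matrix_mulVec continuous_snd)).add
    (continuous_maxCoord.comp (continuous_fst.matrix_vecMul continuous_const).neg)

lemma continuous_H_sumZero :
    Continuous fun x : sumZero (Fin m) × sumZero (Fin n) => H M x.1 x.2 := by
  have hι : Continuous fun x : sumZero (Fin m) × sumZero (Fin n) =>
      ((x.1 : Fin m → ℝ), (x.2 : Fin n → ℝ)) := by fun_prop
  have h := (continuous_H M).comp hι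
  exact h

variable {M} {pbar : Fin m → ℝ} {qbar : Fin n → ℝ} {v : ℝ}

lemma H_add (hq : ∀ i, (M *ᵥ qbar) i = v) (hp : ∀ j, (pbar ᵥ* M) j = v)
    (u : Fin m → ℝ) (w : Fin n → ℝ) : H M (pbar + u) (qbar + w) = H M u w := by
  have h1 : M *ᵥ (qbar + w) = fun i => v + (M *ᵥ w) i := by
    ext i
    simp [mulVec_add, hq]
  have h2 : -((pbar + u) ᵥ* M) = fun j => -v + (-(u ᵥ* M)) j := by
    ext j
    simp [add_vecMul, hp]
    ring
  rw [H_eq_maxCoord, H_eq_maxCoord, h1, h2, maxCoord_const_add, maxCoord_const_add]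
  ring

lemma H_pos (hpbar : pbar ∈ stdSimplex ℝ (Fin m)) (hqbar : qbar ∈ stdSimplex ℝ (Fin n))
    (hppos : ∀ i, 0 < pbar i) (hqpos : ∀ j, 0 < qbar j)
    (huniq : ∀ p ∈ stdSimplex ℝ (Fin m), ∀ q ∈ stdSimplex ℝ (Fin n),
      (∀ p' ∈ stdSimplex ℝ (Fin m), p' ⬝ᵥ M *ᵥ q ≤ p ⬝ᵥ M *ᵥ q) →
      (∀ q' ∈ stdSimplex ℝ (Fin n), p ⬝ᵥ M *ᵥ q ≤ p ⬝ᵥ M *ᵥ q') →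
      p = pbar ∧ q = qbar)
    (hq : ∀ i, (M *ᵥ qbar) i = v) (hp : ∀ j, (pbar ᵥ* M) j = v)
    {u : Fin m → ℝ} {w : Fin n → ℝ} (hu : u ∈ sumZero (Fin m)) (hw : w ∈ sumZero (Fin n))
    (hne : (u, w) ≠ 0) : 0 < H M u w := by
  rw [mem_sumZero] at hu hw
  have hMw : pbar ⬝ᵥ M *ᵥ w = 0 := by
    rw [dotProduct_mulVec, dotProduct]
    simp only [hp, ← Finset.mul_sum, hw, mul_zero]
  have huM : qbar ⬝ᵥ -(u ᵥ* M) = 0 := by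
    rw [dotProduct_neg, dotProduct_comm, ← dotProduct_mulVec, dotProduct]
    simp only [hq, ← Finset.sum_mul, hu, zero_mul, neg_zero]
  have h1 := maxCoord_nonneg hpbar hMw
  have h2 := maxCoord_nonneg hqbar huM
  by_contra! hle
  rw [H_eq_maxCoord] at hle
  have hMw0 : ∀ i, (M *ᵥ w) i ≤ 0 := fun i => (le_maxCoord _ i).trans (by linarith)
  have huM0 : ∀ j, (-(u ᵥ* M)) j ≤ 0 := fun j => (le_maxCoord _ j).trans (by linarith)
  obtain ⟨δ₁, hδ₁, hs₁⟩ := exists_add_mem_stdSimplex hpbar hppos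
  obtain ⟨δ₂, hδ₂, hs₂⟩ := exists_add_mem_stdSimplex hqbar hqpos
  obtain ⟨ε, hε, hεn⟩ : ∃ ε > 0, ε * ‖(u, w)‖ < min δ₁ δ₂ := by
    have hn := norm_pos_iff.2 hne
    have hδ := lt_min hδ₁ hδ₂
    refine ⟨min δ₁ δ₂ / 2 / ‖(u, w)‖, by positivity, ?_⟩
    rw [div_mul_cancel₀ _ hn.ne']
    linarith
  have hpm : pbar + ε • u ∈ stdSimplex ℝ (Fin m) := by
    refine hs₁ _ (by simp [← Finset.mul_sum, hu]) ?_
    rw [norm_smul, Real.norm_of_nonneg hε.le]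
    exact (mul_le_mul_of_nonneg_left (norm_fst_le (u, w)) hε.le).trans_lt
      (hεn.trans_le (min_le_left _ _))
  have hqm : qbar + ε • w ∈ stdSimplex ℝ (Fin n) := by
    refine hs₂ _ (by simp [← Finset.mul_sum, hw]) ?_
    rw [norm_smul, Real.norm_of_nonneg hε.le]
    exact (mul_le_mul_of_nonneg_left (norm_snd_le (u, w)) hε.le).trans_lt
      (hεn.trans_le (min_le_right _ _))
  have hup : ∀ p' ∈ stdSimplex ℝ (Fin m), p' ⬝ᵥ M *ᵥ (qbar + ε • w) ≤ v := fun p' hp' => by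
    refine dotProduct_le_of_mem_stdSimplex hp' fun i => ?_
    have := mul_nonpos_of_nonneg_of_nonpos hε.le (hMw0 i)
    simp only [mulVec_add, mulVec_smul, Pi.add_apply, Pi.smul_apply, hq, smul_eq_mul]
    linarith
  have hlow : ∀ q' ∈ stdSimplex ℝ (Fin n), v ≤ (pbar + ε • u) ⬝ᵥ M *ᵥ q' := fun q' hq' => by
    have : q' ⬝ᵥ -((pbar + ε • u) ᵥ* M) ≤ -v := by
      refine dotProduct_le_of_mem_stdSimplex hq' fun j => ?_
      have := mul_nonpos_of_nonneg_of_nonpos hε.le (huM0 j)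
      simp only [add_vecMul, smul_vecMul, Pi.add_apply, Pi.neg_apply, Pi.smul_apply, hp,
        smul_eq_mul] at this ⊢
      linarith
    rw [dotProduct_neg, dotProduct_comm, ← dotProduct_mulVec] at this
    linarith
  obtain ⟨h3, h4⟩ := huniq _ hpm _ hqm (fun p' hp' => (hup p' hp').trans (hlow _ hqm))
    (fun q' hq' => (hup _ hpm).trans (hlow q' hq'))
  refine hne (Prod.ext ?_ ?_)
  · simpa [hε.ne'] using h3
  · simpa [hε.ne'] using h4

/-- Translation by the equilibrium identifies the level set of `H` in the product of simplices
with the level set of `H` on pairs of vectors with zero coordinate sum. -/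
noncomputable def levelSetHomeomorphSumZero {ρ : ℝ}
    (hpbar : pbar ∈ stdSimplex ℝ (Fin m)) (hqbar : qbar ∈ stdSimplex ℝ (Fin n))
    (hq : ∀ i, (M *ᵥ qbar) i = v) (hp : ∀ j, (pbar ᵥ* M) j = v)
    (hmem : ∀ x : sumZero (Fin m) × sumZero (Fin n), H M x.1 x.2 = ρ →
      pbar + x.1 ∈ stdSimplex ℝ (Fin m) ∧ qbar + x.2 ∈ stdSimplex ℝ (Fin n)) :
    {x : (Fin m → ℝ) × (Fin n → ℝ) //
      x.1 ∈ stdSimplex ℝ (Fin m) ∧ x.2 ∈ stdSimplex ℝ (Fin n) ∧ H M x.1 x.2 = ρ} ≃ₜ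
    {y : sumZero (Fin m) × sumZero (Fin n) // H M y.1 y.2 = ρ} where
  toFun x := ⟨(⟨x.1.1 - pbar, sub_mem_sumZero x.2.1 hpbar⟩,
      ⟨x.1.2 - qbar, sub_mem_sumZero x.2.2.1 hqbar⟩), by
    rw [← H_add hq hp, add_sub_cancel, add_sub_cancel, x.2.2.2]⟩
  invFun y := ⟨(pbar + y.1.1, qbar + y.1.2),
    (hmem _ y.2).1, (hmem _ y.2).2, (H_add hq hp _ _).trans y.2⟩
  left_inv x := by
    apply Subtype.ext
    simp
  right_inv y := by
    apply Subtype.ext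
    simp
  continuous_toFun := by fun_prop
  continuous_invFun := by fun_prop

end Game

theorem level_sets_are_spheres {m n : ℕ} (M : Matrix (Fin m) (Fin n) ℝ)
    (pbar : Fin m → ℝ) (qbar : Fin n → ℝ)
    (hpbar : pbar ∈ stdSimplex ℝ (Fin m)) (hqbar : qbar ∈ stdSimplex ℝ (Fin n))
    (hppos : ∀ i, 0 < pbar i) (hqpos : ∀ j, 0 < qbar j)
    (hmax : ∀ p' ∈ stdSimplex ℝ (Fin m), p' ⬝ᵥ M *ᵥ qbar ≤ pbar ⬝ᵥ M *ᵥ qbar)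
    (hmin : ∀ q' ∈ stdSimplex ℝ (Fin n), pbar ⬝ᵥ M *ᵥ qbar ≤ pbar ⬝ᵥ M *ᵥ q')
    (huniq : ∀ p ∈ stdSimplex ℝ (Fin m), ∀ q ∈ stdSimplex ℝ (Fin n),
      (∀ p' ∈ stdSimplex ℝ (Fin m), p' ⬝ᵥ M *ᵥ q ≤ p ⬝ᵥ M *ᵥ q) →
      (∀ q' ∈ stdSimplex ℝ (Fin n), p ⬝ᵥ M *ᵥ q ≤ p ⬝ᵥ M *ᵥ q') →
      p = pbar ∧ q = qbar) :
    ∃ ρ₀ > 0, ∀ ρ : ℝ, 0 < ρ → ρ < ρ₀ →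
      (∀ p ∈ stdSimplex ℝ (Fin m), ∀ q ∈ stdSimplex ℝ (Fin n), (p, q) ≠ (pbar, qbar) →
        ∃! t : ℝ, 0 < t ∧
          pbar + t • (p - pbar) ∈ stdSimplex ℝ (Fin m) ∧
          qbar + t • (q - qbar) ∈ stdSimplex ℝ (Fin n) ∧
          H M (pbar + t • (p - pbar)) (qbar + t • (q - qbar)) = ρ) ∧
      Nonempty ({x : (Fin m → ℝ) × (Fin n → ℝ) //
          x.1 ∈ stdSimplex ℝ (Fin m) ∧ x.2 ∈ stdSimplex ℝ (Fin n) ∧ H M x.1 x.2 = ρ} ≃ₜ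
        Metric.sphere (0 : EuclideanSpace ℝ (Fin (m + n - 2))) 1) := by
  have : NeZero m := ⟨by rintro rfl; simpa using hpbar.2⟩
  have : NeZero n := ⟨by rintro rfl; simpa using hqbar.2⟩
  set v := pbar ⬝ᵥ M *ᵥ qbar
  have hq : ∀ i, (M *ᵥ qbar) i = v :=
    eq_const_of_le_of_dotProduct_eq hpbar hppos
      (fun i => by simpa using hmax _ (single_mem_stdSimplex ℝ i)) rfl
  have hp : ∀ j, (pbar ᵥ* M) j = v := fun j => by
    have := eq_const_of_le_of_dotProduct_eq (x := -(pbar ᵥ* M)) (a := -v) hqbar hqpos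
      (fun j => by
        have := hmin _ (single_mem_stdSimplex ℝ j)
        rw [dotProduct_mulVec pbar, dotProduct_single_one] at this
        exact neg_le_neg this)
      (by rw [dotProduct_neg, dotProduct_comm, ← dotProduct_mulVec]) j
    simpa using this
  obtain ⟨g, hg⟩ : ∃ g : sumZero (Fin m) × sumZero (Fin n) → ℝ, ∀ x, g x = H M x.1 x.2 :=
    ⟨_, fun _ => rfl⟩
  have hgc : Continuous g := by
    rw [funext hg]
    exact continuous_H_sumZero M
  have hghom : ∀ t : ℝ, 0 < t → ∀ x, g (t • x) = t * g x := fun t ht x => by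
    rw [hg, hg]
    exact H_smul M ht _ _
  have hgpos : ∀ x, x ≠ 0 → 0 < g x := fun x hx => by
    rw [hg]
    exact H_pos hpbar hqbar hppos hqpos huniq hq hp x.1.2 x.2.2 fun h => hx <| by
      simpa [Prod.ext_iff] using h
  obtain ⟨c, hc, hcg⟩ := exists_pos_mul_norm_le g hgc hghom hgpos
  obtain ⟨δ₁, hδ₁, hs₁⟩ := exists_add_mem_stdSimplex hpbar hppos
  obtain ⟨δ₂, hδ₂, hs₂⟩ := exists_add_mem_stdSimplex hqbar hqpos
  refine ⟨c * min δ₁ δ₂, mul_pos hc (lt_min hδ₁ hδ₂), fun ρ hρ hρ₀ => ?_⟩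
  have hmem : ∀ x : sumZero (Fin m) × sumZero (Fin n), g x = ρ →
      pbar + x.1 ∈ stdSimplex ℝ (Fin m) ∧ qbar + x.2 ∈ stdSimplex ℝ (Fin n) := fun x hx => by
    have hn : ‖x‖ < min δ₁ δ₂ :=
      lt_of_mul_lt_mul_left ((hcg x).trans_lt (hx ▸ hρ₀)) hc.le
    exact ⟨hs₁ _ (mem_sumZero.1 x.1.2) ((norm_fst_le x).trans_lt (hn.trans_le (min_le_left _ _))),
      hs₂ _ (mem_sumZero.1 x.2.2) ((norm_snd_le x).trans_lt (hn.trans_le (min_le_right _ _)))⟩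
  constructor
  · intro p hpm q hqm hne
    let d : sumZero (Fin m) × sumZero (Fin n) :=
      (⟨p - pbar, sub_mem_sumZero hpm hpbar⟩, ⟨q - qbar, sub_mem_sumZero hqm hqbar⟩)
    have hd : 0 < g d := hgpos d fun h => hne <| by
      simpa [d, Prod.ext_iff, sub_eq_zero] using h
    obtain ⟨s, hs⟩ : ∃ s, s = ρ / g d := ⟨_, rfl⟩
    have hs0 : 0 < s := hs ▸ div_pos hρ hd
    have hgs : g (s • d) = ρ := by rw [hghom _ hs0, hs, div_mul_cancel₀ _ hd.ne']
    obtain ⟨h1, h2⟩ := hmem _ hgs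
    have hgd : H M (p - pbar) (q - qbar) = g d := (hg d).symm
    have hH : ∀ t : ℝ, 0 < t → H M (pbar + t • (p - pbar)) (qbar + t • (q - qbar)) = t * g d :=
      fun t ht => by rw [H_add hq hp, H_smul M ht, hgd]
    refine ⟨s, ⟨hs0, h1, h2, ?_⟩, ?_⟩
    · rw [hH s hs0, ← hghom s hs0, hgs]
    · rintro t ⟨ht0, -, -, ht⟩
      rw [hH t ht0] at ht
      rw [hs]
      exact eq_div_of_mul_eq hd.ne' ht
  · have hfr : Module.finrank ℝ (sumZero (Fin m) × sumZero (Fin n)) =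
        Module.finrank ℝ (EuclideanSpace ℝ (Fin (m + n - 2))) := by
      have h1 := finrank_sumZero (Fin m)
      have h2 := finrank_sumZero (Fin n)
      rw [Fintype.card_fin] at h1 h2
      rw [Module.finrank_prod, finrank_euclideanSpace_fin]
      omega
    have e₁ := levelSetHomeomorphSumZero hpbar hqbar hq hp fun x hx => hmem x ((hg x).trans hx)
    have e₂ : {x : sumZero (Fin m) × sumZero (Fin n) // H M x.1 x.2 = ρ} ≃ₜ {x // g x = ρ} :=
      (Homeomorph.refl _).subtype fun x => by rw [Homeomorph.refl_apply, id, hg]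
    exact nonempty_homeomorph_sphere_of_finrank_eq hfr g hgc hghom hgpos hρ (e₁.trans e₂)
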